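/- Let n ≥ 1 and define φ̃ : ℝⁿ → ℝⁿ × ℝⁿ × ℝ by φ̃(t₁,…,tₙ) = ((cos t₁ − 1, …, cos tₙ − 1), (sin t₁, …, sin tₙ), ½∑_{j=1}^n (t_j − sin t_j)). Then φ̃ is smooth; for every t ∈ ℝⁿ and every i, the partial derivative ∂φ̃/∂t_i(t) lies in the kernel of θ_{φ̃(t)} (i.e. its last component equals ½(x(t)·∂_i y(t) − y(t)·∂_i x(t)), where x(t), y(t) are the first two component blocks of φ̃(t)); and the projections of ∂φ̃/∂t_1(t), …, ∂φ̃/∂t_n(t) to ℝ^{2n} (forgetting the last coordinate) form an orthonormal system. Hence φ̃ is a horizontal (Legendrian) isometric immersion of ℝⁿ into the Heisenberg group, a lift of the generalized Clifford torus S¹ × ⋯ × S¹ ⊂ ℂⁿ. -/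

import Mathlib

open scoped BigOperators

/-- The Legendrian lift of (an exact covering of) the generalized Clifford torus:
`φ̃(t) = ((cos tᵢ − 1)ᵢ, (sin tᵢ)ᵢ, ½ ∑ⱼ (tⱼ − sin tⱼ))` as a map into the
Heisenberg group `ℝⁿ × ℝⁿ × ℝ`. -/
noncomputable def cliffordLift (n : ℕ) (t : Fin n → ℝ) :
    (Fin n → ℝ) × (Fin n → ℝ) × ℝ :=
  (fun i => Real.cos (t i) - 1, fun i => Real.sin (t i),
    (1 / 2) * ∑ j, (t j - Real.sin (t j)))

theorem hasFDerivAt_cliffordLift (n : ℕ) (t : Fin n → ℝ) :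
    HasFDerivAt (cliffordLift n)
      ((ContinuousLinearMap.pi fun k =>
          (-Real.sin (t k)) • ContinuousLinearMap.proj (R := ℝ) (φ := fun _ : Fin n => ℝ) k).prod
        ((ContinuousLinearMap.pi fun k =>
            Real.cos (t k) • ContinuousLinearMap.proj (R := ℝ) (φ := fun _ : Fin n => ℝ) k).prod
          ((1 / 2 : ℝ) • ∑ k, (ContinuousLinearMap.proj (R := ℝ) (φ := fun _ : Fin n => ℝ) k -
            Real.cos (t k) • ContinuousLinearMap.proj (R := ℝ) (φ := fun _ : Fin n => ℝ) k)))) t := by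
  have hproj (k : Fin n) : HasFDerivAt (fun s : Fin n → ℝ => s k)
      (ContinuousLinearMap.proj (R := ℝ) (φ := fun _ : Fin n => ℝ) k) t :=
    hasFDerivAt_apply k t
  refine HasFDerivAt.prodMk ?_ (HasFDerivAt.prodMk ?_ ?_)
  · exact hasFDerivAt_pi.2 fun k => (hproj k).cos.sub_const 1
  · exact hasFDerivAt_pi.2 fun k => (hproj k).sin
  · exact (HasFDerivAt.fun_sum fun k _ => (hproj k).sub (hproj k).sin).const_mul (1 / 2)

theorem fderiv_cliffordLift_single (n : ℕ) (t : Fin n → ℝ) (i : Fin n) :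
    fderiv ℝ (cliffordLift n) t (Pi.single i 1) =
      (Pi.single i (-Real.sin (t i)), Pi.single i (Real.cos (t i)),
        (1 / 2) * (1 - Real.cos (t i))) := by
  rw [(hasFDerivAt_cliffordLift n t).fderiv]
  refine Prod.ext ?_ (Prod.ext ?_ ?_)
  · ext k
    rcases eq_or_ne k i with rfl | h <;> simp [*]
  · ext k
    rcases eq_or_ne k i with rfl | h <;> simp [*]
  · simp [Finset.sum_sub_distrib, Pi.single_apply]

/-- The lifted Clifford torus map is smooth; each partial derivative `∂φ̃/∂tᵢ(t)` is
horizontal, i.e. lies in the kernel of the contact form `θ_{φ̃(t)}` (its last component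
equals `½(x(t)·∂ᵢy(t) − y(t)·∂ᵢx(t))`); and the horizontal projections of the partial
derivatives form an orthonormal system.  Hence `φ̃` is a horizontal (Legendrian)
isometric immersion of `ℝⁿ` into the Heisenberg group. -/
theorem cliffordLift_horizontal_isometric (n : ℕ) (hn : 1 ≤ n) :
    ContDiff ℝ (⊤ : ℕ∞) (cliffordLift n) ∧
    (∀ (t : Fin n → ℝ) (i : Fin n),
      (fderiv ℝ (cliffordLift n) t (Pi.single i 1)).2.2
        = (1 / 2) *
            ((∑ k, (cliffordLift n t).1 k
                * (fderiv ℝ (cliffordLift n) t (Pi.single i 1)).2.1 k)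
             - ∑ k, (cliffordLift n t).2.1 k
                * (fderiv ℝ (cliffordLift n) t (Pi.single i 1)).1 k)) ∧
    (∀ (t : Fin n → ℝ) (i j : Fin n),
      ((∑ k, (fderiv ℝ (cliffordLift n) t (Pi.single i 1)).1 k
          * (fderiv ℝ (cliffordLift n) t (Pi.single j 1)).1 k)
       + ∑ k, (fderiv ℝ (cliffordLift n) t (Pi.single i 1)).2.1 k
          * (fderiv ℝ (cliffordLift n) t (Pi.single j 1)).2.1 k)
        = if i = j then 1 else 0) := by
  refine ⟨?_, fun t i => ?_, fun t i j => ?_⟩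
  · unfold cliffordLift
    fun_prop
  · simp only [fderiv_cliffordLift_single, cliffordLift, Pi.single_apply, mul_ite, mul_zero,
      Finset.sum_ite_eq', Finset.mem_univ, if_true]
    linear_combination (-1 / 2) * Real.sin_sq_add_cos_sq (t i)
  · simp only [fderiv_cliffordLift_single]
    rcases eq_or_ne i j with rfl | h
    · simp only [Pi.single_apply, mul_ite, mul_zero, Finset.sum_ite_eq',
        Finset.mem_univ, if_true]
      linear_combination Real.sin_sq_add_cos_sq (t i)
    · simp [Pi.single_apply, h, h.symm]
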